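/- arXiv:math/0403319 — 9 statements merged into one kernel-verified Lean document; each statement's English description precedes it below -/
import Mathlib

section
/- Let G be a group and σ an involutory automorphism of G. If x, x', y, y' ∈ G satisfy σ(x'·x⁻¹) = x'·x⁻¹ and σ(y'·y⁻¹) = y'·y⁻¹, then the elements w = σ(y)·σ(x)⁻¹·x and w' = σ(y')·σ(x')⁻¹·x' satisfy σ(w'·w⁻¹) = w'·w⁻¹. (Hence the product I_σx · I_σy = I_σ(σ(y)·σ(x)⁻¹·x) on right cosets of I_σ is well defined.) -/
/-- For an involutory automorphism `σ` of a group `G`, the product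
`I_σ x · I_σ y = I_σ (σ(y) σ(x)⁻¹ x)` on right cosets of the fixed-point
subgroup `I_σ` is well defined: if `x' x⁻¹` and `y' y⁻¹` are fixed by `σ`,
then so is `w' w⁻¹`, where `w = σ(y) σ(x)⁻¹ x` and `w' = σ(y') σ(x')⁻¹ x'`. -/
theorem coset_product_well_defined {G : Type*} [Group G]
    (σ : G ≃* G) (hσ : ∀ g : G, σ (σ g) = g)
    (x x' y y' : G)
    (hx : σ (x' * x⁻¹) = x' * x⁻¹) (hy : σ (y' * y⁻¹) = y' * y⁻¹) :
    σ ((σ y' * (σ x')⁻¹ * x') * (σ y * (σ x)⁻¹ * x)⁻¹) =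
      (σ y' * (σ x')⁻¹ * x') * (σ y * (σ x)⁻¹ * x)⁻¹ := by
  have fixed_quotient {u v : G} (h : σ (v * u⁻¹) = v * u⁻¹) :
      σ v = v * u⁻¹ * σ u := by
    rw [map_mul, map_inv] at h
    exact mul_inv_eq_iff_eq_mul.mp h
  have h_quot : (σ y' * (σ x')⁻¹ * x') * (σ y * (σ x)⁻¹ * x)⁻¹ = y' * y⁻¹ := by
    rw [fixed_quotient hx, fixed_quotient hy]
    group
  rw [h_quot, hy]
end

section
/- Let G be a group, σ an involutory automorphism of G, N the subgroup generated by G_σ = {x⁻¹σ(x) : x ∈ G}, and φ : N → G a group homomorphism such that φ(φ(x)⁻¹σ(φ(x))) = φ(x) for all x ∈ G_σ. Then for any u, v ∈ φ(G_σ), if σ(u·v⁻¹) = u·v⁻¹ then u = v. (That is, every right coset of I_σ contains at most one element of φ(G_σ).) -/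
/-- The element `g⁻¹ * σ g` of `G_σ`, viewed as an element of the subgroup
`N = ⟨G_σ⟩` generated by `G_σ = {x⁻¹ σ(x) : x ∈ G}`. -/
def sigElem {G : Type*} [Group G] (σ : G ≃* G) (g : G) :
    Subgroup.closure {a : G | ∃ x : G, a = x⁻¹ * σ x} :=
  ⟨g⁻¹ * σ g, Subgroup.subset_closure ⟨g, rfl⟩⟩

/-- Let `σ` be an involutory automorphism of `G`, `N = ⟨G_σ⟩`, and
`φ : N → G` a homomorphism with `φ(φ(x)⁻¹ σ(φ(x))) = φ(x)` for all
`x ∈ G_σ`.  Then any two elements `u, v` of `φ(G_σ)` lying in the same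
right coset of `I_σ` (i.e. with `σ(u v⁻¹) = u v⁻¹`) are equal. -/
theorem coset_contains_at_most_one_element_of_phi_Gsigma
    {G : Type*} [Group G] (σ : G ≃* G) (hσ : ∀ g : G, σ (σ g) = g)
    (φ : ↥(Subgroup.closure {a : G | ∃ x : G, a = x⁻¹ * σ x}) →* G)
    (hφ : ∀ g : G, φ (sigElem σ (φ (sigElem σ g))) = φ (sigElem σ g)) :
    ∀ a b : G,
      σ (φ (sigElem σ a) * (φ (sigElem σ b))⁻¹) =
        φ (sigElem σ a) * (φ (sigElem σ b))⁻¹ →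
      φ (sigElem σ a) = φ (sigElem σ b) := by
  intro a b h
  rw [← hφ a, ← hφ b]
  congr 1
  apply Subtype.ext
  rw [map_mul, map_inv, mul_inv_eq_iff_eq_mul] at h
  simp only [sigElem] at h ⊢
  rw [h]
  group
end

section
/- Let G be a (σ,φ)-group and set T = φ(G_σ) and I = I_σ ∩ φ(N). Then there is a binary operation ∘ on T such that for all a, b ∈ T, a∘b is the unique element c of T with a·b·c⁻¹ ∈ I, and (T, ∘) is a Bol loop: 1 ∈ T is a two-sided identity, for all a, b ∈ T the equations a∘x = b and y∘a = b have unique solutions in T, and the right Bol identity ((x∘y)∘z)∘y = x∘((y∘z)∘y) holds for all x, y, z ∈ T. -/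
section SigElem

variable {G : Type*} [Group G] (σ : G ≃* G)

theorem sigElem_mul_of_fixed {h : G} (hh : σ h = h) (g : G) :
    sigElem σ (h * g) = sigElem σ g :=
  Subtype.ext (by simp [sigElem, hh, mul_assoc])

theorem sigElem_one : sigElem σ (1 : G) = 1 :=
  Subtype.ext (by simp [sigElem])

theorem sigElem_apply (hσ : ∀ g : G, σ (σ g) = g) (g : G) :
    sigElem σ (σ g) = (sigElem σ g)⁻¹ :=
  Subtype.ext (by simp [sigElem, hσ])

/-- `G_σ` is closed under `(a, b) ↦ a * b * a`. -/
theorem sigElem_mul_mul (hσ : ∀ g : G, σ (σ g) = g) (u v : G) :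
    sigElem σ u * sigElem σ v * sigElem σ u = sigElem σ (v * (σ u)⁻¹ * u) :=
  Subtype.ext (by simp [sigElem, hσ, mul_assoc])

end SigElem

/-- Let `G` be a `(σ,φ)`-group: `σ` is an involutory automorphism of `G`,
`N = ⟨G_σ⟩`, `φ : N → G` is a homomorphism, `T = φ(G_σ)`,
`I = I_σ ∩ φ(N)`, such that
(1) `G` is generated by `T ∪ σ(T)`,
(2) `φ(φ(x)⁻¹ σ(φ(x))) = φ(x)` for all `x ∈ G_σ`, and
(3) every right coset of `I` in `φ(N)` contains an element of `T`.
Then there is a binary operation `∘` on `T`, where `a ∘ b` is the unique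
`c ∈ T` with `a * b * c⁻¹ ∈ I`, making `T` into a (right) Bol loop with
identity element `1 ∈ T`. -/
theorem sigma_phi_group_gives_Bol_loop
    {G : Type*} [Group G] (σ : G ≃* G) (hσ : ∀ g : G, σ (σ g) = g)
    (φ : ↥(Subgroup.closure {a : G | ∃ x : G, a = x⁻¹ * σ x}) →* G)
    (T : Set G) (hT : T = Set.range fun g : G => φ (sigElem σ g))
    (I : Set G) (hI : I = {g : G | σ g = g} ∩ Set.range φ)
    (h1 : Subgroup.closure (T ∪ σ '' T) = ⊤)
    (h2 : ∀ g : G, φ (sigElem σ (φ (sigElem σ g))) = φ (sigElem σ g))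
    (h3 : ∀ g ∈ Set.range φ, ∃ t ∈ T, g * t⁻¹ ∈ I) :
    ∃ mul : T → T → T,
      (∀ a b c : T, mul a b = c ↔ (a : G) * (b : G) * (c : G)⁻¹ ∈ I) ∧
      ∃ e1 : (1 : G) ∈ T,
        (∀ a : T, mul ⟨1, e1⟩ a = a ∧ mul a ⟨1, e1⟩ = a) ∧
        (∀ a b : T, ∃! x : T, mul a x = b) ∧
        (∀ a b : T, ∃! y : T, mul y a = b) ∧
        (∀ x y z : T, mul (mul (mul x y) z) y = mul x (mul (mul y z) y)) := by
  subst hT hI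
  set s : G → G := fun g => φ (sigElem σ g) with hs
  have s_mem (g : G) : s g ∈ Set.range s := ⟨g, rfl⟩
  have s_of_mem {t : G} (ht : t ∈ Set.range s) : s t = t := by
    obtain ⟨g, rfl⟩ := ht
    exact h2 g
  have s_fixed_mul {h : G} (hh : σ h = h) (g : G) : s (h * g) = s g := by
    simp only [hs, sigElem_mul_of_fixed σ hh]
  have range_of_mem {t : G} (ht : t ∈ Set.range s) : t ∈ φ.range := by
    obtain ⟨g, rfl⟩ := ht
    exact ⟨_, rfl⟩
  have s_eq_of_coset {g t : G} (ht : t ∈ Set.range s) (h : σ (g * t⁻¹) = g * t⁻¹) :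
      s g = t := by
    rw [← s_of_mem ht, ← s_fixed_mul h t, inv_mul_cancel_right]
  have coset {g : G} (hg : g ∈ φ.range) :
      g * (s g)⁻¹ ∈ {g : G | σ g = g} ∩ Set.range φ := by
    obtain ⟨t, ht, htI⟩ := h3 g hg
    rwa [s_eq_of_coset ht htI.1]
  have s_s_mul {g : G} (hg : g ∈ φ.range) (k : G) : s (s g * k) = s (g * k) := by
    rw [← s_fixed_mul (coset hg).1 (s g * k), mul_assoc, inv_mul_cancel_left]
  have one_mem : (1 : G) ∈ Set.range s := ⟨1, by simp [hs, sigElem_one]⟩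
  have inv_mem {t : G} (ht : t ∈ Set.range s) : t⁻¹ ∈ Set.range s := by
    obtain ⟨g, rfl⟩ := ht
    exact ⟨σ g, by simp [hs, sigElem_apply σ hσ]⟩
  have mul_mul_mem {y z : G} (hy : y ∈ Set.range s) (hz : z ∈ Set.range s) :
      y * z * y ∈ Set.range s := by
    obtain ⟨u, rfl⟩ := hy
    obtain ⟨v, rfl⟩ := hz
    exact ⟨v * (σ u)⁻¹ * u, by simp only [hs, ← sigElem_mul_mul σ hσ, map_mul]⟩
  have mul_range {a b : G} (ha : a ∈ Set.range s) (hb : b ∈ Set.range s) :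
      a * b ∈ φ.range := mul_mem (range_of_mem ha) (range_of_mem hb)
  refine ⟨fun a b => ⟨s (a * b), s_mem _⟩, ?_, one_mem, ?_, ?_, ?_, ?_⟩
  · intro a b c
    constructor
    · rintro rfl
      exact coset (mul_range a.2 b.2)
    · intro h
      exact Subtype.ext (s_eq_of_coset c.2 h.1)
  · intro a
    exact ⟨Subtype.ext (by simpa using s_of_mem a.2), Subtype.ext (by simpa using s_of_mem a.2)⟩
  · rintro ⟨a, ha⟩ ⟨b, hb⟩
    refine ⟨⟨a⁻¹ * s (b * a) * a⁻¹, mul_mul_mem (inv_mem ha) (s_mem _)⟩, Subtype.ext ?_, ?_⟩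
    · calc s (a * (a⁻¹ * s (b * a) * a⁻¹)) = s (s (b * a) * a⁻¹) := by group
        _ = b := by rw [s_s_mul (mul_range hb ha), mul_inv_cancel_right, s_of_mem hb]
    · rintro ⟨x, hx⟩ h
      have h : s (a * x) = b := congrArg Subtype.val h
      refine Subtype.ext ?_
      change x = a⁻¹ * s (b * a) * a⁻¹
      rw [← h, s_s_mul (mul_range ha hx), s_of_mem (mul_mul_mem ha hx)]
      group
  · rintro ⟨a, ha⟩ ⟨b, hb⟩
    refine ⟨⟨s (b * a⁻¹), s_mem _⟩, Subtype.ext ?_, ?_⟩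
    · change s (s (b * a⁻¹) * a) = b
      rw [s_s_mul (mul_range hb (inv_mem ha)), inv_mul_cancel_right, s_of_mem hb]
    · rintro ⟨y, hy⟩ h
      have h : s (y * a) = b := congrArg Subtype.val h
      refine Subtype.ext ?_
      change y = s (b * a⁻¹)
      rw [← h, s_s_mul (mul_range hy ha), mul_inv_cancel_right, s_of_mem hy]
  · rintro ⟨x, hx⟩ ⟨y, hy⟩ ⟨z, hz⟩
    refine Subtype.ext ?_
    change s (s (s (x * y) * z) * y) = s (x * s (s (y * z) * y))
    have hxy := mul_range hx hy
    rw [s_s_mul hxy, s_s_mul (mul_mem hxy (range_of_mem hz)), s_s_mul (mul_range hy hz),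
      s_of_mem (mul_mul_mem hy hz)]
    simp only [mul_assoc]
end

section
/- Let G be a (σ,φ)-group in which the homomorphism φ : N → G is injective, and let (T, ∘) be the Bol loop on T = φ(G_σ) determined by: a∘b is the unique element c of T with a·b·c⁻¹ ∈ I, where I = I_σ ∩ φ(N). Then (T, ∘) is a Moufang loop, i.e. it satisfies y∘(z∘(y∘x)) = (y∘(z∘y))∘x for all x, y, z ∈ T. -/
/-- If `g⁻¹ * σ g = k⁻¹ * σ k` then the same holds after multiplying `g` and `k` on the right. -/
theorem inv_mul_map_mul_right_congr {G : Type*} [Group G] (σ : G ≃* G) {g k : G}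
    (h : g⁻¹ * σ g = k⁻¹ * σ k) (u : G) :
    (g * u)⁻¹ * σ (g * u) = (k * u)⁻¹ * σ (k * u) := by
  calc (g * u)⁻¹ * σ (g * u) = u⁻¹ * (g⁻¹ * σ g) * σ u := by simp [mul_assoc]
    _ = (k * u)⁻¹ * σ (k * u) := by rw [h]; simp [mul_assoc]

/-- The set `G_σ` is closed under `(a, b) ↦ a * b * a`. -/
theorem sigElem_mul_mul_self {G : Type*} [Group G] (σ : G ≃* G) (hσ : ∀ g : G, σ (σ g) = g)
    (g k : G) :
    sigElem σ g * sigElem σ k * sigElem σ g = sigElem σ (k * (g⁻¹ * σ g)⁻¹) := by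
  apply Subtype.ext
  simp [sigElem, hσ, mul_assoc]

/-- Let `G` be a `(σ,φ)`-group (with `T = φ(G_σ)` and `I = I_σ ∩ φ(N)`) in
which the homomorphism `φ : N → G` is injective, and let `∘` be the binary
operation on `T` determined by: `a ∘ b` is the unique `c ∈ T` with
`a * b * c⁻¹ ∈ I`.  Then `(T, ∘)` is a Moufang loop, i.e. it satisfies
`y ∘ (z ∘ (y ∘ x)) = (y ∘ (z ∘ y)) ∘ x`. -/
theorem sigma_phi_group_injective_phi_gives_Moufang_loop
    {G : Type*} [Group G] (σ : G ≃* G) (hσ : ∀ g : G, σ (σ g) = g)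
    (φ : ↥(Subgroup.closure {a : G | ∃ x : G, a = x⁻¹ * σ x}) →* G)
    (hinj : Function.Injective φ)
    (T : Set G) (hT : T = Set.range fun g : G => φ (sigElem σ g))
    (I : Set G) (hI : I = {g : G | σ g = g} ∩ Set.range φ)
    (h1 : Subgroup.closure (T ∪ σ '' T) = ⊤)
    (h2 : ∀ g : G, φ (sigElem σ (φ (sigElem σ g))) = φ (sigElem σ g))
    (h3 : ∀ g ∈ Set.range φ, ∃ t ∈ T, g * t⁻¹ ∈ I)
    (mul : T → T → T)
    (hmul : ∀ a b c : T, mul a b = c ↔ (a : G) * (b : G) * (c : G)⁻¹ ∈ I) :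
    ∀ x y z : T, mul y (mul z (mul y x)) = mul (mul y (mul z y)) x := by
  have hs : ∀ g, (φ (sigElem σ g))⁻¹ * σ (φ (sigElem σ g)) = g⁻¹ * σ g := fun g =>
    congrArg Subtype.val (hinj (h2 g))
  have hTinj : ∀ a ∈ T, ∀ b ∈ T, a⁻¹ * σ a = b⁻¹ * σ b → a = b := by
    rw [hT]
    rintro _ ⟨g, rfl⟩ _ ⟨k, rfl⟩ h
    simp only [hs] at h
    exact congrArg φ (Subtype.ext h)
  have hone : (1 : G) ∈ T := by
    rw [hT]
    refine ⟨1, ?_⟩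
    have : sigElem σ 1 = 1 := Subtype.ext (by simp [sigElem])
    simp [this]
  have htwist : ∀ a ∈ T, ∀ b ∈ T, a * b * a ∈ T ∧
      (a * b * a)⁻¹ * σ (a * b * a) = a⁻¹ * σ a * (b⁻¹ * σ b) * (a⁻¹ * σ a) := by
    rw [hT]
    rintro _ ⟨g, rfl⟩ _ ⟨k, rfl⟩
    have h := sigElem_mul_mul_self σ hσ g k
    simp only [← map_mul φ, hs, h]
    exact ⟨⟨_, rfl⟩, congrArg Subtype.val h.symm⟩
  -- Left translation by `a` acts on cosets as right multiplication by `(σ a)⁻¹`.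
  have hleft : ∀ a ∈ T, ∀ b ∈ T,
      (a * b)⁻¹ * σ (a * b) = (b * (σ a)⁻¹)⁻¹ * σ (b * (σ a)⁻¹) := by
    intro a ha b hb
    have h := (htwist a ha b hb).2
    calc (a * b)⁻¹ * σ (a * b)
        = a * ((a * b * a)⁻¹ * σ (a * b * a)) * (σ a)⁻¹ := by simp [mul_assoc]
      _ = _ := by rw [h]; simp [hσ, mul_assoc]
  have hmul_left : ∀ a b : T, (mul a b : G)⁻¹ * σ (mul a b) =
      ((b : G) * (σ a)⁻¹)⁻¹ * σ ((b : G) * (σ a)⁻¹) := by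
    intro a b
    have h := (hmul a b _).1 rfl
    rw [hI] at h
    have hfix : σ ((a : G) * b * (mul a b : G)⁻¹) = (a : G) * b * (mul a b : G)⁻¹ := h.1
    rw [← hleft a a.2 b b.2, eq_comm, inv_mul_eq_iff_eq_mul]
    rw [map_mul, map_inv, mul_inv_eq_iff_eq_mul] at hfix
    rw [hfix, mul_assoc]
  have hmul_three : ∀ y z x : T, (mul y (mul z (mul y x)) : G)⁻¹ * σ (mul y (mul z (mul y x))) =
      ((x : G) * (σ (y * z * y))⁻¹)⁻¹ * σ ((x : G) * (σ (y * z * y))⁻¹) := by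
    intro y z x
    rw [hmul_left, inv_mul_map_mul_right_congr σ (hmul_left z (mul y x)),
      inv_mul_map_mul_right_congr σ (inv_mul_map_mul_right_congr σ (hmul_left y x) _)]
    simp only [map_mul, mul_inv_rev, mul_assoc]
  intro x y z
  have hmul_one : mul y ⟨1, hone⟩ = y := (hmul _ _ _).2 <| by
    rw [hI]
    exact ⟨by simp, 1, by simp⟩
  have hyzy : (mul y (mul z y) : G) = y * z * y := by
    have hmem := (htwist y y.2 z z.2).1
    have h := hmul_three y z ⟨1, hone⟩
    rw [hmul_one, ← hleft _ hmem 1 hone, mul_one] at h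
    exact hTinj _ (Subtype.prop _) _ hmem h
  apply Subtype.ext
  apply hTinj _ (Subtype.prop _) _ (Subtype.prop _)
  rw [hmul_three, hmul_left, hyzy]
end

section
/- Let S be a set with a binary operation ·, an element 1, and a unary operation x ↦ x⁻¹ with x·x⁻¹ = 1 for all x. Let G be a group and P : S → G a map with P(1) = 1, P(x⁻¹) = P(x)⁻¹ for all x ∈ S, and such that {P(x) : x ∈ S} generates G. Let H be the subgroup of G generated by the elements P(x)·P(y)·P(x·y)⁻¹ for x, y ∈ S. Then every element g ∈ G lies in a right coset H·P(x) for some x ∈ S; that is, for every g ∈ G there exists x ∈ S with g·P(x)⁻¹ ∈ H. -/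
/-- Let `S` be a set with a binary operation, an element `1`, and an inverse
operation with `x * x⁻¹ = 1`; let `P : S → G` be a map into a group `G` with
`P 1 = 1`, `P x⁻¹ = (P x)⁻¹`, whose image generates `G`.  If `H` is the
subgroup generated by the elements `P x * P y * (P (x*y))⁻¹`, then every
element of `G` lies in a right coset `H * P x` for some `x ∈ S`. -/
theorem every_element_in_coset_of_H_times_Px
    {S : Type*} (mul : S → S → S) (one : S) (inv : S → S)
    (hinv : ∀ x : S, mul x (inv x) = one)
    {G : Type*} [Group G] (P : S → G)
    (hP1 : P one = 1)
    (hPinv : ∀ x : S, P (inv x) = (P x)⁻¹)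
    (hgen : Subgroup.closure (Set.range P) = ⊤)
    (H : Subgroup G)
    (hH : H = Subgroup.closure
      {g : G | ∃ x y : S, g = P x * P y * (P (mul x y))⁻¹}) :
    ∀ g : G, ∃ x : S, g * (P x)⁻¹ ∈ H := by
  have mul_mem_coset (g : G) (y : S) :
      (∃ x : S, g * (P x)⁻¹ ∈ H) → ∃ x : S, g * P y * (P x)⁻¹ ∈ H := by
    rintro ⟨x, hx⟩
    refine ⟨mul x y, ?_⟩
    have hxy : P x * P y * (P (mul x y))⁻¹ ∈ H :=
      hH ▸ Subgroup.subset_closure ⟨x, y, rfl⟩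
    simpa [mul_assoc] using H.mul_mem hx hxy
  intro g
  have hg : g ∈ Subgroup.closure (Set.range P) := hgen ▸ Subgroup.mem_top g
  induction hg using Subgroup.closure_induction_right with
  | one => exact ⟨one, by simp [hP1]⟩
  | mul_right g _ y hy ih =>
    obtain ⟨y, rfl⟩ := hy
    exact mul_mem_coset g y ih
  | mul_inv_cancel g _ y hy ih =>
    obtain ⟨y, rfl⟩ := hy
    exact hPinv y ▸ mul_mem_coset g (inv y) ih
end

section
/- Let S be a set with a binary operation ·, a two-sided identity element e, and a unary operation x ↦ x⁻¹ satisfying x⁻¹·x = e, the right inverse property (y·x)·x⁻¹ = y, and the right Bol identity ((x·y)·z)·y = x·((y·z)·y) for all x, y, z ∈ S. Then for all a, b ∈ S the equation a·x = b has the unique solution x = (a⁻¹·(b·a))·a⁻¹; that is, a·((a⁻¹·(b·a))·a⁻¹) = b, and any x with a·x = b equals (a⁻¹·(b·a))·a⁻¹. -/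
/-- In a right Bol "loop-like" system — a set with a binary operation, a
two-sided identity `e`, and an inverse operation satisfying `x⁻¹ * x = e`,
the right inverse property `(y * x) * x⁻¹ = y`, and the right Bol identity —
the equation `a * x = b` has the unique solution `x = (a⁻¹ * (b * a)) * a⁻¹`. -/
theorem right_bol_division
    {S : Type*} (mul : S → S → S) (e : S) (inv : S → S)
    (he1 : ∀ x : S, mul e x = x) (he2 : ∀ x : S, mul x e = x)
    (hinv : ∀ x : S, mul (inv x) x = e)
    (hrip : ∀ x y : S, mul (mul y x) (inv x) = y)
    (hbol : ∀ x y z : S, mul (mul (mul x y) z) y = mul x (mul (mul y z) y)) :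
    ∀ a b : S,
      mul a (mul (mul (inv a) (mul b a)) (inv a)) = b ∧
      ∀ x : S, mul a x = b → x = mul (mul (inv a) (mul b a)) (inv a) := by
  have mul_inv (a : S) : mul a (inv a) = e := by simpa [he1] using hrip a e
  intro a b
  refine ⟨?_, ?_⟩
  · rw [← hbol, mul_inv, he1, hrip]
  · rintro x rfl
    rw [← hbol, hinv, he1, hrip]
end

section
/- Let S be a loop with identity element e and a unary operation x ↦ x⁻¹ satisfying x·x⁻¹ = e and x⁻¹·x = e, which satisfies the right Bol identity ((x·y)·z)·y = x·((y·z)·y) and the left inverse-type identity x·(x⁻¹·y) = y for all x, y, z ∈ S. Then S is a Moufang loop, i.e. y·(z·(y·x)) = (y·(z·y))·x holds for all x, y, z ∈ S. -/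
/-- A right Bol loop with two-sided inverses satisfying the left inverse
property `x * (x⁻¹ * y) = y` is a Moufang loop. -/
theorem bol_loop_with_left_inverse_property_is_Moufang
    {S : Type*} (mul : S → S → S) (e : S) (inv : S → S)
    (he1 : ∀ x : S, mul e x = x) (he2 : ∀ x : S, mul x e = x)
    (hex : ∀ a b : S, ∃! x : S, mul a x = b)
    (hey : ∀ a b : S, ∃! y : S, mul y a = b)
    (hinv1 : ∀ x : S, mul x (inv x) = e)
    (hinv2 : ∀ x : S, mul (inv x) x = e)
    (hbol : ∀ x y z : S, mul (mul (mul x y) z) y = mul x (mul (mul y z) y))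
    (hlip : ∀ x y : S, mul x (mul (inv x) y) = y) :
    ∀ x y z : S, mul y (mul z (mul y x)) = mul (mul y (mul z y)) x := by
  have inv_inv' (x : S) : inv (inv x) = x :=
    (hex (inv x) e).unique (hinv1 _) (hinv2 x)
  have rip (x y : S) : mul (mul x y) (inv y) = x :=
    (hey y (mul x y)).unique (by rw [hbol, hinv1, he1]) rfl
  have lip' (x y : S) : mul (inv x) (mul x y) = y := by
    simpa only [inv_inv'] using hlip (inv x) y
  have inv_mul (x y : S) : inv (mul x y) = mul (inv y) (inv x) := by
    have h : mul (inv (mul x y)) x = inv y := by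
      simpa only [rip] using lip' (mul x y) (inv y)
    rw [← h, rip]
  intro x y z
  have h := congrArg inv (hbol (inv x) (inv y) (inv z))
  simpa only [inv_mul, inv_inv'] using h
end

section
/- Let G be a group generated by a finite set X of involutions (x·x = 1 for all x ∈ X) such that X is closed under conjugation by its own elements (x·y·x ∈ X for all x, y ∈ X). Then every element of G can be written as the product of a list of pairwise distinct elements of X; in particular, every element of G is a product of at most |X| elements of X. -/
/-- If `X` consists of involutions and is closed under conjugation by its own elements, then
every word in `X` has the same product as a word without repetitions that is no longer. -/
theorem exists_nodup_list_prod_eq {G : Type*} [Group G] {X : Set G}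
    (hinv : ∀ x ∈ X, x * x = 1) (hconj : ∀ x ∈ X, ∀ y ∈ X, x * y * x ∈ X)
    (l : List G) (hl : ∀ x ∈ l, x ∈ X) :
    ∃ l' : List G, l'.Nodup ∧ (∀ x ∈ l', x ∈ X) ∧ l'.length ≤ l.length ∧ l'.prod = l.prod := by
  induction hn : l.length using Nat.strong_induction_on generalizing l with
  | _ n ih =>
    subst hn
    cases l with
    | nil => exact ⟨[], by simp⟩
    | cons x t =>
      have hx : x ∈ X := hl x (by simp)
      obtain ⟨t', htn, htX, htl, htp⟩ :=
        ih t.length (by simp) t (fun y hy => hl y (by simp [hy])) rfl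
      by_cases hxt : x ∈ t'
      · obtain ⟨a, b, rfl⟩ := List.append_of_mem hxt
        have hlen : (a.map (MulAut.conj x) ++ b).length < (x :: t).length := by
          simp at htl ⊢
          omega
        have hxi : x⁻¹ = x := inv_eq_of_mul_eq_one_left (hinv x hx)
        obtain ⟨l', hn, hX, hlen', hp⟩ := ih _ hlen (a.map (MulAut.conj x) ++ b) (by
          intro y hy
          rcases List.mem_append.1 hy with hy | hy
          · obtain ⟨z, hz, rfl⟩ := List.mem_map.1 hy
            rw [MulAut.conj_apply, hxi]
            exact hconj x hx z (htX z (by simp [hz]))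
          · exact htX y (by simp [hy])) rfl
        refine ⟨l', hn, hX, hlen'.trans hlen.le, ?_⟩
        rw [hp, List.prod_cons, ← htp, List.prod_append, List.prod_append, List.prod_cons,
          ← map_list_prod, MulAut.conj_apply, hxi]
        group
      · exact ⟨x :: t', List.nodup_cons.2 ⟨hxt, htn⟩,
          List.forall_mem_cons.2 ⟨hx, htX⟩, by simpa using htl, by simp [htp]⟩

/-- If a group `G` is generated by a finite set `X` of involutions that is
closed under conjugation by its own elements, then every element of `G` is a
product of a list of pairwise distinct elements of `X`; in particular it is a
product of at most `|X|` elements of `X`. -/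
theorem generated_by_closed_set_of_involutions
    {G : Type*} [Group G] (X : Finset G)
    (hgen : Subgroup.closure (X : Set G) = ⊤)
    (hinv : ∀ x ∈ X, x * x = 1)
    (hconj : ∀ x ∈ X, ∀ y ∈ X, x * y * x ∈ X) :
    ∀ g : G, ∃ l : List G, l.Nodup ∧ (∀ x ∈ l, x ∈ X) ∧
      l.length ≤ X.card ∧ l.prod = g := by
  classical
  intro g
  have hXinv : (X : Set G)⁻¹ ⊆ X := fun x hx => by
    have hx' : x⁻¹ ∈ X := hx
    rwa [← inv_inv x, inv_eq_of_mul_eq_one_left (hinv _ hx')]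
  have hg : g ∈ (Subgroup.closure (X : Set G)).toSubmonoid := by simp [hgen]
  rw [Subgroup.closure_toSubmonoid, Set.union_eq_self_of_subset_right hXinv] at hg
  obtain ⟨l, hlX, rfl⟩ := Submonoid.exists_list_of_mem_closure hg
  obtain ⟨l', hn, hX, -, hp⟩ := exists_nodup_list_prod_eq hinv hconj l hlX
  refine ⟨l', hn, hX, ?_, hp⟩
  rw [← List.toFinset_card_of_nodup hn]
  exact Finset.card_le_card fun x hx => hX x (List.mem_toFinset.1 hx)
end

section
/- Let S be a finite Bol loop with identity element e, and for x ∈ S let x⁻¹ denote the unique element with x·x⁻¹ = e. Let G̃(S) be the group presented by generators P_x and R_x for x ∈ S, subject to the relations P_e = 1, R_e = 1, P_{x⁻¹} = P_x⁻¹, R_{x⁻¹} = R_x⁻¹, P_{(x·y)·x} = P_x·P_y·P_x, R_{(x·y)·x} = R_x·R_y·R_x, and P_x·P_y·P_{x·y}⁻¹ = R_x⁻¹·R_y⁻¹·R_{x·y}, for all x, y ∈ S. Then G̃(S) is residually finite: for every element g ≠ 1 of G̃(S) there is a normal subgroup of finite index in G̃(S) not containing g. -/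
/-- A permutation representation of a free group on a finite set separates a given word from `1`:
partial translations on the set of suffixes of the word are extended to permutations. -/
theorem FreeGroup.exists_finite_hom_ne_one.{u} {α : Type u} {g : FreeGroup α} (hg : g ≠ 1) :
    ∃ (Q : Type u) (_ : Group Q) (_ : Finite Q) (f : FreeGroup α →* Q), f g ≠ 1 := by
  classical
  obtain ⟨L, rfl⟩ := Quot.exists_rep g
  change FreeGroup.mk L ≠ 1 at hg
  let X : Set (FreeGroup α) := FreeGroup.mk '' {l | l ∈ L.tails}
  have hX : X.Finite := (List.finite_toSet L.tails).image _
  have : Fintype X := hX.fintype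
  have hone : (1 : FreeGroup α) ∈ X := ⟨[], by simp, rfl⟩
  have hperm (a : α) : ∃ π : Equiv.Perm X, ∀ x y : X, FreeGroup.of a * x.1 = y.1 → π x = y := by
    let p : X → Prop := fun x => FreeGroup.of a * x.1 ∈ X
    let q : X → Prop := fun y => (FreeGroup.of a)⁻¹ * y.1 ∈ X
    let E : {x // p x} ≃ {y // q y} :=
      { toFun := fun x => ⟨⟨_, x.2⟩, by simp [q]⟩
        invFun := fun y => ⟨⟨_, y.2⟩, by simp [p]⟩
        left_inv := fun x => by simp
        right_inv := fun y => by simp }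
    refine ⟨E.extendSubtype, fun x y h => ?_⟩
    have hx : p x := by simp only [p, h, y.2]
    rw [Equiv.extendSubtype_apply_of_mem E x hx]
    exact Subtype.ext h
  choose π hπ using hperm
  refine ⟨Equiv.Perm X, inferInstance, inferInstance, FreeGroup.lift π, fun h => hg ?_⟩
  have key : ∀ (l : List (α × Bool)) (hl : l <:+ L),
      ((FreeGroup.lift π (FreeGroup.mk l)) ⟨1, hone⟩).1 = FreeGroup.mk l := by
    intro l
    induction l with
    | nil => intro _; rw [← FreeGroup.one_eq_mk, _root_.map_one]; rfl
    | cons c l ih =>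
      intro hl
      have hl' : l <:+ L := (List.suffix_cons c l).trans hl
      have hmem : FreeGroup.mk l ∈ X := ⟨l, by simpa using hl', rfl⟩
      have hmem' : FreeGroup.mk (c :: l) ∈ X := ⟨c :: l, by simpa using hl, rfl⟩
      have hstep : (FreeGroup.lift π (FreeGroup.mk l)) ⟨1, hone⟩ = ⟨_, hmem⟩ :=
        Subtype.ext (ih hl')
      obtain ⟨a, b⟩ := c
      have hsplit : FreeGroup.mk ((a, b) :: l) = FreeGroup.mk [(a, b)] * FreeGroup.mk l := by
        rw [FreeGroup.mul_mk]; rfl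
      conv_lhs => rw [hsplit, _root_.map_mul, Equiv.Perm.mul_apply, hstep]
      cases b
      · have hinv : FreeGroup.mk [(a, false)] = (FreeGroup.of a)⁻¹ := rfl
        rw [hinv] at hsplit ⊢
        rw [_root_.map_inv, FreeGroup.lift_apply_of, Equiv.Perm.inv_def,
          (Equiv.symm_apply_eq _).2 (hπ a ⟨_, hmem'⟩ ⟨_, hmem⟩ (by simp [hsplit])).symm]
      · rw [show FreeGroup.mk [(a, true)] = FreeGroup.of a from rfl, FreeGroup.lift_apply_of,
          hπ a ⟨_, hmem⟩ ⟨_, hmem'⟩ hsplit.symm]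
  change FreeGroup.mk L = 1
  rw [← key L List.suffix_rfl]
  rw [show FreeGroup.lift π (FreeGroup.mk L) = 1 from h]
  rfl

open scoped IsMulCommutative in
/-- A group whose center has finite index and which is generated by finitely many elements of
finite order is finite. -/
theorem Group.finite_of_finiteIndex_center {A : Type*} [Group A] [(Subgroup.center A).FiniteIndex]
    {K : Set A} (hK : K.Finite) (hgen : Subgroup.closure K = ⊤)
    (htors : ∀ a ∈ K, IsOfFinOrder a) : Finite A := by
  have : Group.FG A := Group.fg_iff.2 ⟨K, hgen, hK⟩
  have hall (g : A) : IsOfFinOrder g := by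
    have hle : Subgroup.closure K ≤
        (CommGroup.torsion (Subgroup.center A)).comap (MonoidHom.transferCenterPow A) := by
      rw [Subgroup.closure_le]
      intro a ha
      exact (MonoidHom.transferCenterPow A).isOfFinOrder (htors a ha)
    have hg : IsOfFinOrder (MonoidHom.transferCenterPow A g) := hle (hgen ▸ Subgroup.mem_top g)
    have hg' := (Subgroup.center A).subtype.isOfFinOrder hg
    rw [Subgroup.coe_subtype, MonoidHom.transferCenterPow_apply] at hg'
    exact hg'.of_pow Subgroup.FiniteIndex.index_ne_zero
  have : Finite (Subgroup.center A) := by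
    exact CommGroup.finite_of_fg_isMulTorsion _ fun z => Submonoid.isOfFinOrder_coe.1 (hall z)
  exact Finite.of_equiv _ (Subgroup.groupEquivQuotientProdSubgroup (s := Subgroup.center A)).symm

/-- A group generated by a finite set `K` closed under `(a, b) ↦ a * b * a` is finite as soon as
it has an anti-automorphism fixing `K` pointwise. -/
theorem Group.finite_of_twisted_generators {A : Type*} [Group A] {K : Set A} (hK : K.Finite)
    (hone : 1 ∈ K) (hinv : ∀ a ∈ K, a⁻¹ ∈ K) (hmul : ∀ a ∈ K, ∀ b ∈ K, a * b * a ∈ K)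
    (hgen : Subgroup.closure K = ⊤) (τ : A →* Aᵐᵒᵖ) (hτ : ∀ a ∈ K, τ a = MulOpposite.op a) :
    Finite A := by
  have hpow : ∀ a ∈ K, ∀ n : ℕ, a ^ n ∈ K ∧ a ^ (n + 1) ∈ K := by
    intro a ha n
    induction n with
    | zero => simpa using ⟨hone, ha⟩
    | succ n ih =>
      refine ⟨ih.2, ?_⟩
      have := hmul a ha _ ih.1
      rwa [← pow_succ', ← pow_succ] at this
  have htors (a : A) (ha : a ∈ K) : IsOfFinOrder a := by
    by_contra h
    exact (Set.infinite_range_of_injective (injective_pow_iff_not_isOfFinOrder.2 h)).mono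
      (Set.range_subset_iff.2 fun n => (hpow a ha n).1) hK
  have hstab (g : A) : ∀ b ∈ K, g * b * (τ g).unop ∈ K := by
    have hg : g ∈ Subgroup.closure K := hgen ▸ Subgroup.mem_top g
    induction hg using Subgroup.closure_induction'' with
    | mem a ha => intro b hb; rw [hτ a ha]; exact hmul a ha b hb
    | inv_mem a ha =>
      intro b hb
      rw [map_inv, hτ a ha]
      exact hmul _ (hinv a ha) b hb
    | one => intro b hb; simpa using hb
    | mul x y _ _ hx hy =>
      intro b hb
      have := hx _ (hy b hb)
      simpa [mul_assoc] using this
  have : Finite K := hK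
  let _ : MulAction A K :=
    { smul := fun g b => ⟨g * b * (τ g).unop, hstab g b b.2⟩
      one_smul := fun b => Subtype.ext (by
        change 1 * b.1 * (τ 1).unop = b.1
        simp)
      mul_smul := fun g h b => Subtype.ext (by
        change (g * h) * b.1 * (τ (g * h)).unop = g * (h * b.1 * (τ h).unop) * (τ g).unop
        simp [mul_assoc]) }
  have hker : (MulAction.toPermHom A K).ker ≤ Subgroup.center A := by
    intro g hg
    have hfix (b : A) (hb : b ∈ K) : g * b * (τ g).unop = b :=
      congrArg Subtype.val (DFunLike.congr_fun (MonoidHom.mem_ker.1 hg) (⟨b, hb⟩ : K))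
    have hτg : (τ g).unop = g⁻¹ := by
      have := hfix 1 hone
      rw [mul_one] at this
      exact eq_inv_of_mul_eq_one_right this
    have hle : Subgroup.closure K ≤ Subgroup.centralizer {g} := by
      rw [Subgroup.closure_le]
      intro b hb
      have := hfix b hb
      rw [hτg, mul_inv_eq_iff_eq_mul] at this
      exact Subgroup.mem_centralizer_singleton_iff.2 this.symm
    rw [Subgroup.mem_center_iff]
    intro b
    exact Subgroup.mem_centralizer_singleton_iff.1 (hle (hgen ▸ Subgroup.mem_top b))
  have : (Subgroup.center A).FiniteIndex := Subgroup.finiteIndex_of_le hker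
  exact Group.finite_of_finiteIndex_center hK hgen htors

/-- The action of a group on the free group over a set on which it acts. -/
def FreeGroup.permAction (A Ω : Type*) [Group A] [MulAction A Ω] :
    A →* MulAut (FreeGroup Ω) where
  toFun a := FreeGroup.freeGroupCongr (MulAction.toPerm a)
  map_one' := by ext x; induction x using FreeGroup.induction_on <;> simp_all
  map_mul' a b := by ext x; induction x using FreeGroup.induction_on <;> simp_all [mul_smul]

theorem FreeGroup.permAction_of {A Ω : Type*} [Group A] [MulAction A Ω] (a : A) (w : Ω) :
    FreeGroup.permAction A Ω a (FreeGroup.of w) = FreeGroup.of (a • w) := by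
  simp [FreeGroup.permAction]

theorem SemidirectProduct.inl_of_mul_inr_comm {A : Type*} [Group A] {H : Subgroup A} {h : A}
    (hh : h ∈ H) :
    (inl (FreeGroup.of ((1 : A) : A ⧸ H)) * inr h :
      FreeGroup (A ⧸ H) ⋊[FreeGroup.permAction A (A ⧸ H)] A) =
      inr h * inl (FreeGroup.of ((1 : A) : A ⧸ H)) := by
  have hfix : h • ((1 : A) : A ⧸ H) = ((1 : A) : A ⧸ H) := by
    rw [MulAction.Quotient.smul_coe, smul_eq_mul, mul_one]
    exact (QuotientGroup.eq.2 (by simpa using hh)).symm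
  refine SemidirectProduct.ext ?_ ?_
  · rw [mul_left, mul_left, left_inl, right_inl, right_inr, left_inr,
      FreeGroup.permAction_of, hfix, _root_.map_one, mul_one, one_mul]
  · simp

/-- Let `G` be generated by two images of a finite group `A` that agree on a subgroup `H`, and
suppose that `G` maps to the semidirect product of the free group over `A ⧸ H` with `A` in such a
way that the first copy of `A` goes to `A` and the second one to its conjugate by the free
generator `H`. Then `G` is residually finite (it is the double of `A` along `H`). -/
theorem exists_normal_finiteIndex_notMem_of_double {A G : Type*} [Group A] [Finite A] [Group G]
    (H : Subgroup A) (i j : A →* G) (hij : ∀ h ∈ H, i h = j h)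
    (hgen : Subgroup.closure (Set.range i ∪ Set.range j) = ⊤)
    (θ : G →* FreeGroup (A ⧸ H) ⋊[FreeGroup.permAction A (A ⧸ H)] A)
    (hi : ∀ a, θ (i a) = SemidirectProduct.inr a)
    (hj : ∀ a, θ (j a) = SemidirectProduct.inl (FreeGroup.of ((1 : A) : A ⧸ H)) *
      SemidirectProduct.inr a * (SemidirectProduct.inl (FreeGroup.of ((1 : A) : A ⧸ H)))⁻¹)
    {g : G} (hg : g ≠ 1) : ∃ N : Subgroup G, N.Normal ∧ N.FiniteIndex ∧ g ∉ N := by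
  let u : A ⧸ H → G := Quotient.lift (fun a => i a * (j a)⁻¹) (by
    intro a b hab
    have h := hij _ (QuotientGroup.leftRel_apply.1 hab)
    simp only [map_mul, map_inv] at h
    rw [inv_mul_eq_iff_eq_mul] at h
    simp only [h]
    group)
  have hu (a : A) : u (a : A ⧸ H) = i a * (j a)⁻¹ := rfl
  have hleft (a : A) : (θ (j a)).left =
      FreeGroup.of ((1 : A) : A ⧸ H) * (FreeGroup.of (a : A ⧸ H))⁻¹ := by
    rw [hj]
    simp [FreeGroup.permAction_of, -MulAction.Quotient.mk_smul_out,
      -QuotientGroup.mk_mul]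
  have hright (a : A) : (θ (j a)).right = a := by
    rw [hj]
    simp
  let ρ : FreeGroup (A ⧸ H) →* G := FreeGroup.lift u
  have key (x : G) : x = ρ (θ x).left * i (θ x).right := by
    have hx : x ∈ Subgroup.closure (Set.range i ∪ Set.range j) := hgen ▸ Subgroup.mem_top x
    have stepi (x : G) (a : A) (h : x = ρ (θ x).left * i (θ x).right) :
        x * i a = ρ (θ (x * i a)).left * i (θ (x * i a)).right := by
      simp only [map_mul, hi, SemidirectProduct.mul_left, SemidirectProduct.mul_right,
        SemidirectProduct.left_inr, SemidirectProduct.right_inr, map_one, mul_one]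
      rw [← mul_assoc, ← h]
    have stepj (x : G) (a : A) (h : x = ρ (θ x).left * i (θ x).right) :
        x * j a = ρ (θ (x * j a)).left * i (θ (x * j a)).right := by
      conv_lhs => rw [h]
      simp only [map_mul, SemidirectProduct.mul_left, SemidirectProduct.mul_right, hleft, hright,
        map_inv, FreeGroup.permAction_of, MulAction.Quotient.smul_coe, smul_eq_mul, mul_one,
        ρ, FreeGroup.lift_apply_of, hu]
      group
    induction hx using Subgroup.closure_induction_right with
    | one => simp
    | mul_right x _ z hz h =>
      rcases hz with ⟨a, rfl⟩ | ⟨a, rfl⟩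
      · exact stepi _ _ h
      · exact stepj _ _ h
    | mul_inv_cancel x _ z hz h =>
      rcases hz with ⟨a, rfl⟩ | ⟨a, rfl⟩
      · rw [← map_inv]; exact stepi _ _ h
      · rw [← map_inv]; exact stepj _ _ h
  let r : G →* A := SemidirectProduct.rightHom.comp θ
  have hr : r.ker.FiniteIndex := inferInstance
  by_cases hgr : g ∈ r.ker
  swap
  · exact ⟨r.ker, inferInstance, hr, hgr⟩
  have hright_ker (k : r.ker) : (θ k).right = 1 := k.2
  let l : r.ker →* FreeGroup (A ⧸ H) :=
    { toFun := fun k => (θ k).left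
      map_one' := by simp
      map_mul' := fun k k' => by simp [hright_ker] }
  have hl : l ⟨g, hgr⟩ ≠ 1 := by
    intro h
    apply hg
    rw [key g, show (θ g).left = 1 from h, hright_ker ⟨g, hgr⟩]
    simp
  obtain ⟨Q, _, _, f, hf⟩ := FreeGroup.exists_finite_hom_ne_one hl
  let M : Subgroup G := (f.comp l).ker.map r.ker.subtype
  have hM : M.FiniteIndex := by
    refine ⟨?_⟩
    rw [Subgroup.index_map_subtype]
    exact mul_ne_zero Subgroup.FiniteIndex.index_ne_zero hr.index_ne_zero
  refine ⟨M.normalCore, inferInstance, inferInstance, fun h => ?_⟩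
  obtain ⟨k, hk, hkg⟩ := M.normalCore_le h
  obtain rfl : k = ⟨g, hgr⟩ := Subtype.ext hkg
  exact hf hk

/-- Families of group elements satisfying the relations `p e = 1`, `p x⁻¹ = (p x)⁻¹` and
`p ((x * y) * x) = p x * p y * p x`. -/
structure IsTwistedFamily {S G : Type*} [Group G] (mul : S → S → S) (e : S) (inv : S → S)
    (p : S → G) : Prop where
  map_e : p e = 1
  map_inv (x : S) : p (inv x) = (p x)⁻¹
  map_mul_mul (x y : S) : p (mul (mul x y) x) = p x * p y * p x

theorem IsTwistedFamily.inv_apply {S G : Type*} [Group G] {mul : S → S → S} {e : S}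
    {inv : S → S} {p : S → G} (hp : IsTwistedFamily mul e inv p) :
    IsTwistedFamily mul e inv fun x => (p x)⁻¹ where
  map_e := by simp [hp.map_e]
  map_inv x := by simp [hp.map_inv]
  map_mul_mul x y := by simp [hp.map_mul_mul, mul_assoc]

theorem IsTwistedFamily.map {S G G' : Type*} [Group G] [Group G'] {mul : S → S → S} {e : S}
    {inv : S → S} {p : S → G} (hp : IsTwistedFamily mul e inv p) (f : G →* G') :
    IsTwistedFamily mul e inv fun x => f (p x) where
  map_e := by simp [hp.map_e]
  map_inv x := by simp [hp.map_inv]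
  map_mul_mul x y := by simp [hp.map_mul_mul]

/-- The defining relations of the group with the universal twisted family. -/
def twistedRels {S : Type*} (mul : S → S → S) (e : S) (inv : S → S) : Set (FreeGroup S) :=
  {FreeGroup.of e} ∪ {w | ∃ x, w = FreeGroup.of (inv x) * FreeGroup.of x} ∪
    {w | ∃ x y, w = FreeGroup.of (mul (mul x y) x) *
      (FreeGroup.of x * FreeGroup.of y * FreeGroup.of x)⁻¹}

theorem isTwistedFamily_of {S : Type*} (mul : S → S → S) (e : S) (inv : S → S) :
    IsTwistedFamily mul e inv
      (PresentedGroup.of : S → PresentedGroup (twistedRels mul e inv)) where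
  map_e := PresentedGroup.one_of_mem (Or.inl (Or.inl rfl))
  map_inv x := eq_inv_of_mul_eq_one_left
    (PresentedGroup.one_of_mem (rels := twistedRels mul e inv) (Or.inl (Or.inr ⟨x, rfl⟩)))
  map_mul_mul x y := PresentedGroup.mk_eq_mk_of_mul_inv_mem
    (rels := twistedRels mul e inv) (Or.inr ⟨x, y, rfl⟩)

/-- The homomorphism out of the universal group determined by a twisted family. -/
def IsTwistedFamily.lift {S G : Type*} [Group G] {mul : S → S → S} {e : S}
    {inv : S → S} {p : S → G} (hp : IsTwistedFamily mul e inv p) :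
    PresentedGroup (twistedRels mul e inv) →* G :=
  PresentedGroup.toGroup (f := p) (by
    rintro r ((rfl | ⟨x, rfl⟩) | ⟨x, y, rfl⟩)
    · simp [hp.map_e]
    · simp [hp.map_inv]
    · simp [hp.map_mul_mul, mul_assoc])

theorem IsTwistedFamily.lift_of {S G : Type*} [Group G] {mul : S → S → S} {e : S}
    {inv : S → S} {p : S → G} (hp : IsTwistedFamily mul e inv p) (x : S) :
    hp.lift (PresentedGroup.of x) = p x :=
  PresentedGroup.toGroup.of _

theorem finite_presentedGroup_twistedRels {S : Type*} [Finite S] (mul : S → S → S) (e : S)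
    (inv : S → S) : Finite (PresentedGroup (twistedRels mul e inv)) := by
  have hp := isTwistedFamily_of mul e inv
  have hop : IsTwistedFamily mul e inv fun x =>
      MulOpposite.op (PresentedGroup.of x : PresentedGroup (twistedRels mul e inv)) :=
    { map_e := by simp [hp.map_e]
      map_inv := fun x => by simp [hp.map_inv]
      map_mul_mul := fun x y => by simp [hp.map_mul_mul, mul_assoc] }
  refine Group.finite_of_twisted_generators (Set.finite_range PresentedGroup.of)
    ⟨e, hp.map_e⟩ ?_ ?_ (PresentedGroup.closure_range_of _) hop.lift ?_
  · rintro _ ⟨x, rfl⟩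
    exact ⟨inv x, hp.map_inv x⟩
  · rintro _ ⟨x, rfl⟩ _ ⟨y, rfl⟩
    exact ⟨_, hp.map_mul_mul x y⟩
  · rintro _ ⟨x, rfl⟩
    exact hop.lift_of x

/-- Let `S` be a finite (right) Bol loop with identity `e` and right inverses
`x * x⁻¹ = e`, and let `G̃(S)` be the group presented by generators
`P_x, R_x` (`x ∈ S`) and the relations
`P_e = 1`, `R_e = 1`, `P_{x⁻¹} = P_x⁻¹`, `R_{x⁻¹} = R_x⁻¹`,
`P_{(x*y)*x} = P_x P_y P_x`, `R_{(x*y)*x} = R_x R_y R_x`, and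
`P_x P_y P_{x*y}⁻¹ = R_x⁻¹ R_y⁻¹ R_{x*y}`.
Then `G̃(S)` is residually finite: every non-identity element is excluded by
some normal subgroup of finite index.
Here `P_x` is encoded as `FreeGroup.of (Sum.inl x)` and `R_x` as
`FreeGroup.of (Sum.inr x)`. -/
theorem presented_group_of_finite_bol_loop_residually_finite
    {S : Type} [Fintype S] (mul : S → S → S) (e : S) (inv : S → S)
    (he1 : ∀ x : S, mul e x = x) (he2 : ∀ x : S, mul x e = x)
    (hex : ∀ a b : S, ∃! x : S, mul a x = b)
    (hey : ∀ a b : S, ∃! y : S, mul y a = b)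
    (hbol : ∀ x y z : S, mul (mul (mul x y) z) y = mul x (mul (mul y z) y))
    (hinv : ∀ x : S, mul x (inv x) = e)
    (rels : Set (FreeGroup (S ⊕ S)))
    (hrels : rels =
      {FreeGroup.of (Sum.inl e), FreeGroup.of (Sum.inr e)} ∪
      {w | ∃ x : S,
        w = FreeGroup.of (Sum.inl (inv x)) * FreeGroup.of (Sum.inl x)} ∪
      {w | ∃ x : S,
        w = FreeGroup.of (Sum.inr (inv x)) * FreeGroup.of (Sum.inr x)} ∪
      {w | ∃ x y : S,
        w = FreeGroup.of (Sum.inl (mul (mul x y) x)) *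
          (FreeGroup.of (Sum.inl x) * FreeGroup.of (Sum.inl y) *
            FreeGroup.of (Sum.inl x))⁻¹} ∪
      {w | ∃ x y : S,
        w = FreeGroup.of (Sum.inr (mul (mul x y) x)) *
          (FreeGroup.of (Sum.inr x) * FreeGroup.of (Sum.inr y) *
            FreeGroup.of (Sum.inr x))⁻¹} ∪
      {w | ∃ x y : S,
        w = (FreeGroup.of (Sum.inl x) * FreeGroup.of (Sum.inl y) *
            (FreeGroup.of (Sum.inl (mul x y)))⁻¹) *
          ((FreeGroup.of (Sum.inr x))⁻¹ * (FreeGroup.of (Sum.inr y))⁻¹ *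
            FreeGroup.of (Sum.inr (mul x y)))⁻¹}) :
    ∀ g : PresentedGroup rels, g ≠ 1 →
      ∃ N : Subgroup (PresentedGroup rels),
        N.Normal ∧ N.FiniteIndex ∧ g ∉ N := by
  have hmem (w) (hw : w ∈ rels) : PresentedGroup.mk rels w = 1 := PresentedGroup.one_of_mem hw
  let P : S → PresentedGroup rels := fun x => PresentedGroup.of (Sum.inl x)
  let R : S → PresentedGroup rels := fun x => PresentedGroup.of (Sum.inr x)
  have hP : IsTwistedFamily mul e inv P :=
    { map_e := hmem (FreeGroup.of (Sum.inl e)) (by rw [hrels]; simp)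
      map_inv := fun x => eq_inv_of_mul_eq_one_left <|
        hmem (FreeGroup.of (Sum.inl (inv x)) * FreeGroup.of (Sum.inl x))
          (by rw [hrels]; exact Or.inl (Or.inl (Or.inl (Or.inl (Or.inr ⟨x, rfl⟩)))))
      map_mul_mul := fun x y => PresentedGroup.mk_eq_mk_of_mul_inv_mem
          (by rw [hrels]; exact Or.inl (Or.inl (Or.inr ⟨x, y, rfl⟩))) }
  have hR : IsTwistedFamily mul e inv R :=
    { map_e := hmem (FreeGroup.of (Sum.inr e)) (by rw [hrels]; simp)
      map_inv := fun x => eq_inv_of_mul_eq_one_left <|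
        hmem (FreeGroup.of (Sum.inr (inv x)) * FreeGroup.of (Sum.inr x))
          (by rw [hrels]; exact Or.inl (Or.inl (Or.inl (Or.inr ⟨x, rfl⟩))))
      map_mul_mul := fun x y => PresentedGroup.mk_eq_mk_of_mul_inv_mem
          (by rw [hrels]; exact Or.inl (Or.inr ⟨x, y, rfl⟩)) }
  have hPR (x y : S) : P x * P y * (P (mul x y))⁻¹ = (R x)⁻¹ * (R y)⁻¹ * R (mul x y) :=
    PresentedGroup.mk_eq_mk_of_mul_inv_mem (by rw [hrels]; exact Or.inr ⟨x, y, rfl⟩)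
  let A := PresentedGroup (twistedRels mul e inv)
  let p : S → A := PresentedGroup.of
  have hp : IsTwistedFamily mul e inv p := isTwistedFamily_of mul e inv
  have : Finite A := finite_presentedGroup_twistedRels mul e inv
  let H : Subgroup A := Subgroup.closure {h | ∃ x y, h = p x * p y * (p (mul x y))⁻¹}
  let i : A →* PresentedGroup rels := hP.lift
  let j : A →* PresentedGroup rels := hR.inv_apply.lift
  have hi (x : S) : i (p x) = P x := hP.lift_of x
  have hj (x : S) : j (p x) = (R x)⁻¹ := hR.inv_apply.lift_of x
  have hij : H ≤ i.eqLocus j := by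
    rw [Subgroup.closure_le]
    rintro _ ⟨x, y, rfl⟩
    change i _ = j _
    simp [hi, hj, hPR]
  let Γ := FreeGroup (A ⧸ H) ⋊[FreeGroup.permAction A (A ⧸ H)] A
  let t : Γ := SemidirectProduct.inl (FreeGroup.of ((1 : A) : A ⧸ H))
  let c : A →* Γ := (MulAut.conj t).toMonoidHom.comp SemidirectProduct.inr
  have hc (a : A) : c a = t * SemidirectProduct.inr a * t⁻¹ := rfl
  have hcH (h : A) (hh : h ∈ H) : c h = SemidirectProduct.inr h := by
    rw [hc, mul_inv_eq_iff_eq_mul]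
    exact SemidirectProduct.inl_of_mul_inr_comm hh
  have hip := hp.map (SemidirectProduct.inr : A →* Γ)
  have hcp := (hp.map c).inv_apply
  let θ : PresentedGroup rels →* Γ := PresentedGroup.toGroup
    (f := Sum.elim (fun x => SemidirectProduct.inr (p x)) fun x => (c (p x))⁻¹) (by
      rw [hrels]
      rintro r ((((((rfl | rfl) | ⟨x, rfl⟩) | ⟨x, rfl⟩) | ⟨x, y, rfl⟩) | ⟨x, y, rfl⟩) | ⟨x, y, rfl⟩)
      · simpa using hip.map_e
      · simpa using hcp.map_e
      · simpa using mul_eq_one_iff_eq_inv.2 (hip.map_inv x)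
      · simpa using mul_eq_one_iff_eq_inv.2 (hcp.map_inv x)
      · rw [map_mul, map_inv, mul_inv_eq_one]
        simpa using hip.map_mul_mul x y
      · rw [map_mul, map_inv, mul_inv_eq_one]
        simpa using hcp.map_mul_mul x y
      · have := hcH _ (Subgroup.subset_closure ⟨x, y, rfl⟩)
        simp only [map_mul, map_inv] at this
        simp only [map_mul, map_inv, FreeGroup.lift_apply_of, Sum.elim_inl, Sum.elim_inr, inv_inv,
          this, mul_inv_cancel])
  have hθi : θ.comp i = SemidirectProduct.inr := PresentedGroup.ext fun x => by
    change θ (i (p x)) = _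
    rw [hi]
    exact PresentedGroup.toGroup.of _
  have hθj : θ.comp j = c := PresentedGroup.ext fun x => by
    change θ (j (p x)) = c (p x)
    rw [hj, map_inv, inv_eq_iff_eq_inv]
    exact PresentedGroup.toGroup.of _
  have hgen : Subgroup.closure (Set.range i ∪ Set.range j) = ⊤ := by
    rw [eq_top_iff, ← PresentedGroup.closure_range_of, Subgroup.closure_le]
    rintro _ ⟨x | x, rfl⟩
    · exact Subgroup.subset_closure (Or.inl ⟨p x, hi x⟩)
    · exact Subgroup.subset_closure (Or.inr ⟨(p x)⁻¹, by rw [map_inv, hj, inv_inv]⟩)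
  intro g hg
  exact exists_normal_finiteIndex_notMem_of_double H i j hij hgen θ (DFunLike.congr_fun hθi)
    (DFunLike.congr_fun hθj) hg
end
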